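/- (Corollary: GIG quadrature) Let γ, δ > 0, p ∈ ℝ, σ = √(γδ), and n ≥ 1. Let x_k and w_k (k = 1,…,n) be the IG quadrature points and weights for f_IG(·|γ,δ), i.e., x_k = (δ/γ)·φ_σ⁻¹(z_k) and w_k = 2h_k/(1 + φ_σ⁻¹(z_k)) where z_1,…,z_n are the roots of He_n and h_k = (1/He_n'(z_k))·∫_ℝ (He_n(t)/(t−z_k))·φ(t) dt. Define modified weights w̄_k = c(γ,δ,p) · x_k^{p+1/2} · w_k with c(γ,δ,p) = √(π/2) · γ^p · e^{−γδ} / (δ^{p+1} · K_p(γδ)). Then for every real r such that r + p + 1/2 is an integer with 1 − n ≤ r + p + 1/2 ≤ n, Σ_{k=1}^n w̄_k · x_k^r = ∫₀^∞ x^r · f_GIG(x|γ,δ,p) dx. -/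

import Mathlib

open MeasureTheory Real Set

/-- Inverse Gaussian density `f_IG(x | γ, δ)`. -/
noncomputable def fIG (γ δ x : ℝ) : ℝ :=
  δ / Real.sqrt (2 * Real.pi * x ^ 3) * Real.exp (-(γ * x - δ) ^ 2 / (2 * x))

/-- The map `φ_σ(x) = σ (√x − 1/√x)`. -/
noncomputable def phiMap (σ x : ℝ) : ℝ := σ * (Real.sqrt x - 1 / Real.sqrt x)

/-- The inverse map `φ_σ⁻¹(z) = 1 + z²/(2σ²) + (z/σ)√(1 + z²/(4σ²))`. -/
noncomputable def phiInv (σ z : ℝ) : ℝ :=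
  1 + z ^ 2 / (2 * σ ^ 2) + z / σ * Real.sqrt (1 + z ^ 2 / (4 * σ ^ 2))

/-- Standard normal density `φ(z) = exp(−z²/2)/√(2π)`. -/
noncomputable def stdNormalPdf (z : ℝ) : ℝ := Real.exp (-z ^ 2 / 2) / Real.sqrt (2 * Real.pi)

/-- Standard normal cumulative distribution function. -/
noncomputable def stdNormalCDF (z : ℝ) : ℝ := ∫ t in Set.Iic z, stdNormalPdf t

/-- Modified Bessel function of the second kind `K_p(z)` (integral representation). -/
noncomputable def besselK (p z : ℝ) : ℝ :=
  (1 / 2) * ∫ t in Set.Ioi (0 : ℝ), t ^ (p - 1) * Real.exp (-z * (t + 1 / t) / 2)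

/-- Generalized inverse Gaussian density `f_GIG(x | γ, δ, p)`. -/
noncomputable def fGIG (γ δ p x : ℝ) : ℝ :=
  (γ / δ) ^ p * x ^ (p - 1) / (2 * besselK p (γ * δ)) *
    Real.exp (-(γ ^ 2 * x + δ ^ 2 / x) / 2)

/-- Generalized hyperbolic density `f_GH(y | μ, β, γ, δ, p)` with `α = √(β² + γ²)`. -/
noncomputable def fGH (μ β γ δ p y : ℝ) : ℝ :=
  Real.sqrt (Real.sqrt (β ^ 2 + γ ^ 2)) *
      (γ / (Real.sqrt (β ^ 2 + γ ^ 2) * δ)) ^ p /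
      (Real.sqrt (2 * Real.pi) * besselK p (δ * γ)) *
    Real.exp (β * (y - μ)) *
    besselK (p - 1 / 2) (Real.sqrt (β ^ 2 + γ ^ 2) * Real.sqrt (δ ^ 2 + (y - μ) ^ 2)) /
    (δ ^ 2 + (y - μ) ^ 2) ^ ((1 - 2 * p) / 4)


open Polynomial in
theorem integrable_eval_mul_stdNormalPdf (q : ℝ[X]) :
    Integrable fun t : ℝ => q.eval t * stdNormalPdf t := by
  induction q using Polynomial.induction_on' with
  | add p q hp hq =>
    simp only [eval_add, add_mul]
    exact hp.add hq
  | monomial k a =>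
    have key := integrable_rpow_mul_exp_neg_mul_sq (b := 1 / 2) (by norm_num) (s := k)
      (by linarith [(Nat.cast_nonneg k : (0 : ℝ) ≤ k)])
    refine (key.const_mul (a / Real.sqrt (2 * Real.pi))).congr (.of_forall fun t => ?_)
    simp only [eval_monomial, stdNormalPdf, Real.rpow_natCast]
    rw [show -(1 / 2) * t ^ 2 = -t ^ 2 / 2 by ring]
    ring

theorem hasDerivAt_stdNormalPdf (t : ℝ) : HasDerivAt stdNormalPdf (-t * stdNormalPdf t) t := by
  have h : HasDerivAt (fun t : ℝ => -t ^ 2 / 2) (-t) t :=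
    ((hasDerivAt_pow 2 t).neg.div_const 2).congr_deriv (by norm_num; ring)
  refine (h.exp.div_const (Real.sqrt (2 * Real.pi))).congr_deriv ?_
  simp only [stdNormalPdf]
  ring

theorem stdNormalPdf_neg (t : ℝ) : stdNormalPdf (-t) = stdNormalPdf t := by
  simp [stdNormalPdf]

theorem continuous_stdNormalPdf : Continuous stdNormalPdf := by
  unfold stdNormalPdf
  fun_prop

theorem stdNormalPdf_pos (t : ℝ) : 0 < stdNormalPdf t := by
  unfold stdNormalPdf
  positivity

open Polynomial in
/-- Stein's identity for polynomials. -/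
theorem integral_X_mul_eval_mul_stdNormalPdf (q : ℝ[X]) :
    ∫ t : ℝ, (X * q - derivative q).eval t * stdNormalPdf t = 0 := by
  have h := integral_eq_zero_of_hasDerivAt_of_integrable
    (f := fun t : ℝ => q.eval t * stdNormalPdf t)
    (f' := fun t : ℝ => -((X * q - derivative q).eval t * stdNormalPdf t))
    (fun t => ((q.hasDerivAt t).mul (hasDerivAt_stdNormalPdf t)).congr_deriv (by
      simp only [eval_sub, eval_mul, eval_X]
      ring))
    (integrable_eval_mul_stdNormalPdf _).neg (integrable_eval_mul_stdNormalPdf q)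
  rwa [integral_neg, neg_eq_zero] at h

open Polynomial in
/-- The Hermite polynomial of degree `n` is orthogonal to polynomials of smaller degree. -/
theorem integral_hermite_mul_eq_zero (n : ℕ) (q : ℝ[X]) (hq : q.degree < n) :
    ∫ t : ℝ, ((hermite n).map (Int.castRingHom ℝ) * q).eval t * stdNormalPdf t = 0 := by
  induction n generalizing q with
  | zero =>
    have : q = 0 := by simpa using hq
    simp [this]
  | succ n ih =>
    have hd : (derivative q).degree < n := by
      by_cases h0 : q = 0
      · simp [h0]
      have := degree_derivative_lt h0
      have h2 : q.degree ≤ n := by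
        rw [degree_lt_iff_coeff_zero] at hq
        exact (degree_le_iff_coeff_zero _ _).2 fun k hk => hq k (by exact_mod_cast hk)
      exact this.trans_le h2
    set H := (hermite n).map (Int.castRingHom ℝ)
    have h1 := integral_X_mul_eval_mul_stdNormalPdf (H * q)
    have h2 := ih _ hd
    have h3 : (hermite (n + 1)).map (Int.castRingHom ℝ) * q
        = (X * (H * q) - derivative (H * q)) + H * derivative q := by
      simp only [hermite_succ, Polynomial.map_sub, Polynomial.map_mul, map_X, derivative_mul, H,
        derivative_map]
      ring
    rw [h3]
    simp only [eval_add (p := X * (H * q) - derivative (H * q)), add_mul]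
    rw [integral_add (integrable_eval_mul_stdNormalPdf _) (integrable_eval_mul_stdNormalPdf _),
      h1, h2, add_zero]

/-- The Gauss–Hermite weight attached to the node `a`. -/
noncomputable def gaussHermiteWeight (n : ℕ) (a : ℝ) : ℝ :=
  1 / Polynomial.aeval a (Polynomial.derivative (Polynomial.hermite n)) *
    ∫ t : ℝ, Polynomial.aeval t (Polynomial.hermite n) / (t - a) * stdNormalPdf t

open Polynomial in
theorem aeval_hermite_neg (n : ℕ) (t : ℝ) :
    aeval (-t) (hermite n) = (-1) ^ n * aeval t (hermite n) ∧
    aeval (-t) (derivative (hermite n)) = (-1) ^ (n + 1) * aeval t (derivative (hermite n)) := by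
  have key : (hermite n).comp (-X) = (-1) ^ n * hermite n := by
    induction n with
    | zero => simp
    | succ n ih =>
      have hd := congrArg derivative ih
      have h1 : derivative ((-1 : ℤ[X]) ^ n) = 0 := by
        rcases neg_one_pow_eq_or ℤ[X] n with h | h <;> simp [h]
      rw [derivative_comp, derivative_mul, h1] at hd
      simp only [derivative_neg, derivative_X] at hd
      rw [hermite_succ, sub_comp, mul_comp, X_comp, ih]
      linear_combination hd
  have h1 : derivative ((-1 : ℤ[X]) ^ n) = 0 := by
    rcases neg_one_pow_eq_or ℤ[X] n with h | h <;> simp [h]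
  have hd := congrArg derivative key
  rw [derivative_comp, derivative_mul, h1] at hd
  simp only [derivative_neg, derivative_X] at hd
  have e1 := congrArg (aeval t) key
  have e2 := congrArg (aeval t) hd
  simp only [aeval_comp, map_mul, map_neg, map_pow, map_one, aeval_X, zero_mul,
    zero_add] at e1 e2
  refine ⟨e1, ?_⟩
  rw [pow_succ]
  linear_combination -e2

theorem gaussHermiteWeight_neg (n : ℕ) (a : ℝ) :
    gaussHermiteWeight n (-a) = gaussHermiteWeight n a := by
  unfold gaussHermiteWeight
  have h : ∫ t : ℝ, Polynomial.aeval t (Polynomial.hermite n) / (t - -a) * stdNormalPdf t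
      = (-1) ^ (n + 1) *
        ∫ t : ℝ, Polynomial.aeval t (Polynomial.hermite n) / (t - a) * stdNormalPdf t := by
    rw [← integral_neg_eq_self, ← integral_const_mul]
    congr 1 with t
    rw [(aeval_hermite_neg n t).1, stdNormalPdf_neg, show -t - -a = -(t - a) by ring, div_neg,
      pow_succ]
    ring
  rw [h, (aeval_hermite_neg n a).2]
  rcases neg_one_pow_eq_or ℝ (n + 1) with h | h <;> rw [h] <;> simp

open Polynomial in
theorem hermite_map_eq_nodal {n : ℕ} {z : Fin n → ℝ} (hz : Function.Injective z)
    (hroot : ∀ k, aeval (z k) (hermite n) = (0 : ℝ)) :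
    (hermite n).map (Int.castRingHom ℝ) = Lagrange.nodal Finset.univ z := by
  have hm : ((hermite n).map (Int.castRingHom ℝ)).Monic := (hermite_monic n).map _
  have hdeg : ((hermite n).map (Int.castRingHom ℝ)).degree = n := by
    rw [(hermite_monic n).degree_map, degree_hermite]
  refine eq_of_degree_le_of_eval_index_eq Finset.univ hz.injOn (by simp [hdeg])
    (by simp [hdeg]) (by rw [hm.leadingCoeff, Lagrange.nodal_monic.leadingCoeff]) fun k _ => ?_
  rw [Lagrange.eval_nodal_at_node (Finset.mem_univ k), ← hroot k, aeval_def, eval_map]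
  rfl

open Polynomial in
/-- Gauss–Hermite quadrature with `n` nodes is exact on polynomials of degree below `2 * n`. -/
theorem gaussHermite_quadrature {n : ℕ} {z : Fin n → ℝ} (hz : Function.Injective z)
    (hroot : ∀ k, aeval (z k) (hermite n) = (0 : ℝ)) (q : ℝ[X])
    (hq : q.degree < (2 * n : ℕ)) :
    ∑ k, gaussHermiteWeight n (z k) * q.eval (z k) = ∫ t : ℝ, q.eval t * stdNormalPdf t := by
  have hN := hermite_map_eq_nodal hz hroot
  set H := (hermite n).map (Int.castRingHom ℝ) with hH
  have hm : H.Monic := (hermite_monic n).map _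
  have hdeg : H.degree = n := by
    rw [hH, (hermite_monic n).degree_map, degree_hermite]
  have hev : ∀ t : ℝ, aeval t (hermite n) = H.eval t := fun t => by
    rw [aeval_def, hH, eval_map]; rfl
  have hev' : ∀ t : ℝ, aeval t (derivative (hermite n)) = (derivative H).eval t := fun t => by
    rw [aeval_def, hH, derivative_map, eval_map]; rfl
  have hw : ∀ k, ∫ t : ℝ, (Lagrange.basis Finset.univ z k).eval t * stdNormalPdf t
      = gaussHermiteWeight n (z k) := fun k => by
    rw [gaussHermiteWeight, ← integral_const_mul]
    refine integral_congr_ae ?_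
    filter_upwards [compl_mem_ae_iff.2 (measure_singleton (μ := volume) (z k))] with t ht
    rw [Lagrange.eval_basis_not_at_node (Finset.mem_univ k) ht,
      Lagrange.nodalWeight_eq_eval_derivative_nodal (Finset.mem_univ k), hev, hev', ← hN]
    ring
  have hsplit := modByMonic_add_div q H
  have hr : (q %ₘ H).degree < n := hdeg ▸ degree_modByMonic_lt q hm
  have hd : (q /ₘ H).degree < n := by
    by_cases hlt : q.degree < H.degree
    · rw [(divByMonic_eq_zero_iff hm).2 hlt, degree_zero]
      exact WithBot.bot_lt_coe _
    · have h1 := degree_add_divByMonic hm (not_lt.1 hlt)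
      by_contra hcon
      have h2 : (n : WithBot ℕ) + n ≤ q.degree := by
        rw [← h1, hdeg]
        exact add_le_add le_rfl (not_lt.1 hcon)
      refine absurd hq (not_lt.2 (le_trans (le_of_eq ?_) h2))
      norm_cast
      ring
  have hqr : ∀ k, q.eval (z k) = (q %ₘ H).eval (z k) := fun k => by
    conv_lhs => rw [← hsplit]
    rw [eval_add, eval_mul, ← hev, hroot, zero_mul, add_zero]
  have hI : ∫ t : ℝ, q.eval t * stdNormalPdf t
      = ∫ t : ℝ, (q %ₘ H).eval t * stdNormalPdf t := by
    conv_lhs => rw [← hsplit]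
    simp only [eval_add, add_mul]
    rw [integral_add (integrable_eval_mul_stdNormalPdf _) (integrable_eval_mul_stdNormalPdf _),
      integral_hermite_mul_eq_zero n _ hd, add_zero]
  have hfint := Lagrange.eq_interpolate (s := Finset.univ) hz.injOn (f := q %ₘ H) (by simpa using hr)
  rw [hI]
  conv_rhs => rw [hfint]
  simp only [Lagrange.interpolate_apply, eval_finsetSum, eval_mul, eval_C, Finset.sum_mul,
    mul_assoc]
  rw [integral_finsetSum _ fun k _ => (integrable_eval_mul_stdNormalPdf _).const_mul _]
  refine Finset.sum_congr rfl fun k _ => ?_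
  rw [integral_const_mul, hw, hqr, mul_comm]

open Polynomial in
/-- Gauss–Hermite quadrature applied to a function whose symmetrization is a polynomial. -/
theorem gaussHermite_quadrature_of_symm {n : ℕ} {z : Fin n → ℝ} (hz : Function.Injective z)
    (hroot : ∀ k, aeval (z k) (hermite n) = (0 : ℝ)) (q : ℝ[X])
    (hq : q.degree < (2 * n : ℕ)) {f : ℝ → ℝ} (hfc : Continuous f) (hf0 : ∀ t, 0 ≤ f t)
    (hf : ∀ t, f t + f (-t) = q.eval t) :
    ∑ k, gaussHermiteWeight n (z k) * f (z k) = ∫ t : ℝ, f t * stdNormalPdf t := by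
  have hN := hermite_map_eq_nodal hz hroot
  have hex : ∀ k, ∃ j, z j = -z k := fun k => by
    have h1 : aeval (-z k) (hermite n) = (0 : ℝ) := by
      rw [(aeval_hermite_neg n (z k)).1, hroot, mul_zero]
    have h2 : (Lagrange.nodal Finset.univ z).eval (-z k) = 0 := by
      rw [← hN, ← h1, aeval_def, eval_map]; rfl
    rw [Lagrange.eval_nodal, Finset.prod_eq_zero_iff] at h2
    obtain ⟨j, -, hj⟩ := h2
    exact ⟨j, by linarith⟩
  choose e he using hex
  have hinj : Function.Injective e := fun a b hab => hz (by
    have := he a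
    rw [hab, he b] at this
    linarith)
  have hbij : Function.Bijective e := Finite.injective_iff_bijective.1 hinj
  have hS : ∑ k, gaussHermiteWeight n (z k) * f (-z k)
      = ∑ k, gaussHermiteWeight n (z k) * f (z k) := by
    rw [← hbij.sum_comp fun k => gaussHermiteWeight n (z k) * f (z k)]
    refine Finset.sum_congr rfl fun k _ => ?_
    rw [he, gaussHermiteWeight_neg]
  have hfint : Integrable fun t : ℝ => f t * stdNormalPdf t := by
    refine (integrable_eval_mul_stdNormalPdf q).mono'
      (hfc.mul continuous_stdNormalPdf).aestronglyMeasurable (.of_forall fun t => ?_)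
    rw [Real.norm_of_nonneg (mul_nonneg (hf0 t) (stdNormalPdf_pos t).le)]
    exact mul_le_mul_of_nonneg_right (by linarith [hf t, hf0 (-t)]) (stdNormalPdf_pos t).le
  have hneg : ∫ t : ℝ, f (-t) * stdNormalPdf t = ∫ t : ℝ, f t * stdNormalPdf t := by
    rw [← integral_neg_eq_self]
    simp [stdNormalPdf_neg]
  have hfint' : Integrable fun t : ℝ => f (-t) * stdNormalPdf t := by
    simpa only [stdNormalPdf_neg] using hfint.comp_neg
  have hG := gaussHermite_quadrature hz hroot q hq
  simp only [← hf, mul_add, add_mul, Finset.sum_add_distrib] at hG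
  rw [integral_add hfint hfint', hneg, hS] at hG
  linarith

theorem phiInv_add_phiInv_neg (σ z : ℝ) :
    phiInv σ z + phiInv σ (-z) = 2 + z ^ 2 / σ ^ 2 := by
  simp only [phiInv, neg_sq]
  ring

theorem phiInv_mul_phiInv_neg {σ : ℝ} (hσ : 0 < σ) (z : ℝ) :
    phiInv σ z * phiInv σ (-z) = 1 := by
  simp only [phiInv, neg_sq]
  have h : Real.sqrt (1 + z ^ 2 / (4 * σ ^ 2)) ^ 2 = 1 + z ^ 2 / (4 * σ ^ 2) :=
    Real.sq_sqrt (by positivity)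
  have e : (1 + z ^ 2 / (2 * σ ^ 2) + z / σ * Real.sqrt (1 + z ^ 2 / (4 * σ ^ 2))) *
      (1 + z ^ 2 / (2 * σ ^ 2) + -z / σ * Real.sqrt (1 + z ^ 2 / (4 * σ ^ 2)))
      = (1 + z ^ 2 / (2 * σ ^ 2)) ^ 2
        - (z / σ) ^ 2 * Real.sqrt (1 + z ^ 2 / (4 * σ ^ 2)) ^ 2 := by ring
  rw [e, h]
  field_simp
  ring

theorem phiInv_pos {σ : ℝ} (hσ : 0 < σ) (z : ℝ) : 0 < phiInv σ z := by
  have h1 := phiInv_mul_phiInv_neg hσ z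
  have h2 := phiInv_add_phiInv_neg σ z
  have h3 : 0 ≤ z ^ 2 / σ ^ 2 := by positivity
  by_contra! h
  nlinarith

theorem phiInv_neg {σ : ℝ} (hσ : 0 < σ) (z : ℝ) : phiInv σ (-z) = (phiInv σ z)⁻¹ :=
  eq_inv_of_mul_eq_one_right (phiInv_mul_phiInv_neg hσ z)

theorem continuous_phiInv (σ : ℝ) : Continuous (phiInv σ) := by
  unfold phiInv
  fun_prop

open Polynomial in
theorem exists_polynomial_symm {σ : ℝ} (hσ : 0 < σ) (j : ℕ) :
    ∃ q : ℝ[X], q.natDegree ≤ 2 * j ∧ ∀ z : ℝ,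
      (phiInv σ z ^ (j + 1) + (phiInv σ z)⁻¹ ^ j) / (1 + phiInv σ z) = q.eval z := by
  induction j using Nat.twoStepInduction with
  | zero =>
    refine ⟨1, by simp, fun z => ?_⟩
    have := phiInv_pos hσ z
    simp only [eval_one]
    field_simp
    ring
  | one =>
    refine ⟨1 + C (σ ^ 2)⁻¹ * X ^ 2, by compute_degree, fun z => ?_⟩
    have := phiInv_pos hσ z
    have h2 := phiInv_add_phiInv_neg σ z
    rw [phiInv_neg hσ] at h2
    simp only [eval_add, eval_one, eval_mul, eval_C, eval_pow, eval_X]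
    have e : (σ ^ 2)⁻¹ * z ^ 2 = phiInv σ z + (phiInv σ z)⁻¹ - 2 := by rw [h2]; ring
    rw [e]
    field_simp
    ring
  | more j ih1 ih2 =>
    obtain ⟨q1, d1, h1⟩ := ih1
    obtain ⟨q2, d2, h2⟩ := ih2
    refine ⟨(C 2 + C (σ ^ 2)⁻¹ * X ^ 2) * q2 - q1, ?_, fun z => ?_⟩
    · refine (natDegree_sub_le _ _).trans (max_le (natDegree_mul_le.trans ?_) (by omega))
      have : (C 2 + C (σ ^ 2)⁻¹ * X ^ 2 : ℝ[X]).natDegree ≤ 2 := by compute_degree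
      omega
    · have := phiInv_pos hσ z
      have h3 := phiInv_add_phiInv_neg σ z
      rw [phiInv_neg hσ] at h3
      have e : 2 + (σ ^ 2)⁻¹ * z ^ 2 = phiInv σ z + (phiInv σ z)⁻¹ := by rw [h3]; ring
      simp only [eval_sub, eval_add, eval_mul, eval_C, eval_pow, eval_X, ← h1, ← h2]
      rw [e]
      simp only [inv_pow]
      field_simp
      ring

open Polynomial in
/-- The symmetrization of `y ^ m / (1 + y)` with `y = phiInv σ z` is a polynomial in `z`. -/
theorem exists_polynomial_zpow_symm {σ : ℝ} (hσ : 0 < σ) {n : ℕ} {m : ℤ}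
    (hm1 : 1 - (n : ℤ) ≤ m) (hm2 : m ≤ n) :
    ∃ q : ℝ[X], q.degree < (2 * n : ℕ) ∧ ∀ z : ℝ,
      phiInv σ z ^ m / (1 + phiInv σ z) + phiInv σ (-z) ^ m / (1 + phiInv σ (-z)) = q.eval z := by
  have hsymm : ∀ z : ℝ,
      phiInv σ z ^ m / (1 + phiInv σ z) + phiInv σ (-z) ^ m / (1 + phiInv σ (-z))
        = (phiInv σ z ^ m + phiInv σ z ^ (1 - m)) / (1 + phiInv σ z) := fun z => by
    have := phiInv_pos hσ z
    rw [phiInv_neg hσ, inv_zpow', sub_eq_add_neg, zpow_add₀ this.ne', zpow_one]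
    field_simp
    ring
  simp only [hsymm]
  have deg : ∀ (q : ℝ[X]) (j : ℕ), j < n → q.natDegree ≤ 2 * j → q.degree < (2 * n : ℕ) :=
    fun q j hj hq => degree_le_natDegree.trans_lt (by exact_mod_cast (by omega))
  rcases le_or_gt 1 m with h | h
  · obtain ⟨j, rfl⟩ : ∃ j : ℕ, m = j + 1 := ⟨(m - 1).toNat, by omega⟩
    obtain ⟨q, hq, he⟩ := exists_polynomial_symm hσ j
    refine ⟨q, deg q j (by omega) hq, fun z => ?_⟩
    rw [← he, show (1 : ℤ) - (j + 1) = -j by ring, zpow_neg, zpow_natCast, inv_pow]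
    norm_cast
  · obtain ⟨j, rfl⟩ : ∃ j : ℕ, m = -j := ⟨(-m).toNat, by omega⟩
    obtain ⟨q, hq, he⟩ := exists_polynomial_symm hσ j
    refine ⟨q, deg q j (by omega) hq, fun z => ?_⟩
    rw [← he, show (1 : ℤ) - -j = (j + 1 : ℕ) by push_cast; ring, zpow_neg, zpow_natCast,
      zpow_natCast, inv_pow, add_comm]

theorem phiInv_sub_div {γ δ u : ℝ} (hγ : 0 < γ) (hδ : 0 < δ) (hu : 0 < u) :
    phiInv (Real.sqrt (γ * δ)) (γ * u - δ / u) = γ / δ * u ^ 2 := by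
  have hs : Real.sqrt (γ * δ) ^ 2 = γ * δ := Real.sq_sqrt (by positivity)
  have hσ : 0 < Real.sqrt (γ * δ) := Real.sqrt_pos.2 (by positivity)
  set σ := Real.sqrt (γ * δ)
  have h1 : Real.sqrt (1 + (γ * u - δ / u) ^ 2 / (4 * σ ^ 2)) = (γ * u + δ / u) / (2 * σ) := by
    rw [Real.sqrt_eq_iff_mul_self_eq (by positivity) (by positivity), div_mul_div_comm,
      show 2 * σ * (2 * σ) = 4 * σ ^ 2 by ring, hs]
    field_simp
    ring
  rw [phiInv, h1, div_mul_div_comm, show σ * (2 * σ) = 2 * σ ^ 2 by ring, hs]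
  field_simp
  ring

/-- Change of variables `z = γ √t - δ / √t` in a Gaussian integral. -/
theorem integral_zpow_phiInv_mul_stdNormalPdf {γ δ : ℝ} (hγ : 0 < γ) (hδ : 0 < δ) (m : ℤ) :
    ∫ z : ℝ, phiInv (Real.sqrt (γ * δ)) z ^ m / (1 + phiInv (Real.sqrt (γ * δ)) z) *
        stdNormalPdf z
      = δ / 2 * (γ / δ) ^ m * Real.exp (γ * δ) / Real.sqrt (2 * Real.pi) *
        ∫ t in Ioi (0 : ℝ), t ^ ((m : ℝ) - 3 / 2) *
          Real.exp (-(γ ^ 2 * t + δ ^ 2 / t) / 2) := by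
  set ψ : ℝ → ℝ := fun t => γ * Real.sqrt t - δ / Real.sqrt t with hψ
  have hleft : ∀ t ∈ Ioi (0 : ℝ), phiInv (Real.sqrt (γ * δ)) (ψ t) = γ / δ * t := fun t ht => by
    have ht : 0 < t := ht
    rw [hψ, phiInv_sub_div hγ hδ (Real.sqrt_pos.2 ht), Real.sq_sqrt ht.le]
  have hinj : InjOn ψ (Ioi 0) := fun a ha b hb hab => by
    have h := hleft a ha
    rw [hab, hleft b hb] at h
    exact (mul_left_cancel₀ (by positivity) h).symm
  have himg : ψ '' Ioi 0 = univ := by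
    refine eq_univ_of_forall fun z => ?_
    have hs : Real.sqrt (z ^ 2 + 4 * γ * δ) ^ 2 = z ^ 2 + 4 * γ * δ :=
      Real.sq_sqrt (by positivity)
    have hpos : 0 < z + Real.sqrt (z ^ 2 + 4 * γ * δ) := by
      have : |z| < Real.sqrt (z ^ 2 + 4 * γ * δ) := by
        rw [← Real.sqrt_sq_eq_abs]
        exact Real.sqrt_lt_sqrt (sq_nonneg z) (by nlinarith [mul_pos hγ hδ])
      linarith [neg_abs_le z]
    set s := Real.sqrt (z ^ 2 + 4 * γ * δ)
    have hu : 0 < (z + s) / (2 * γ) := by positivity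
    refine ⟨((z + s) / (2 * γ)) ^ 2, by simp only [mem_Ioi]; positivity, ?_⟩
    simp only [hψ]
    rw [Real.sqrt_sq hu.le]
    field_simp
    linear_combination hs
  have hder : ∀ t ∈ Ioi (0 : ℝ), HasDerivWithinAt ψ
      ((γ * t + δ) / (2 * (t * Real.sqrt t))) (Ioi 0) t := fun t ht => by
    have ht : 0 < t := ht
    have hst := Real.sqrt_pos.2 ht
    have hs2 := Real.sq_sqrt ht.le
    have h := (((Real.hasDerivAt_sqrt ht.ne').const_mul γ).sub
      ((hasDerivAt_const t δ).div (Real.hasDerivAt_sqrt ht.ne') hst.ne'))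
    refine (h.congr_deriv ?_).hasDerivWithinAt
    rw [hs2]
    field_simp
    ring
  rw [← setIntegral_univ, ← himg,
    integral_image_eq_integral_abs_deriv_smul measurableSet_Ioi hder hinj, ← integral_const_mul]
  refine setIntegral_congr_fun measurableSet_Ioi fun t ht => ?_
  have hl := hleft t ht
  have ht : 0 < t := ht
  have hst := Real.sqrt_pos.2 ht
  have hs2 := Real.sq_sqrt ht.le
  have hexp : stdNormalPdf (ψ t) = Real.exp (γ * δ) *
      Real.exp (-(γ ^ 2 * t + δ ^ 2 / t) / 2) / Real.sqrt (2 * Real.pi) := by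
    rw [stdNormalPdf, ← Real.exp_add]
    congr 2
    have : ψ t ^ 2 = γ ^ 2 * Real.sqrt t ^ 2 + δ ^ 2 / Real.sqrt t ^ 2 - 2 * (γ * δ) := by
      simp only [hψ]
      field_simp
      ring
    rw [this, hs2]
    ring
  have hpow : t ^ ((m : ℝ) - 3 / 2) = t ^ m / (t * Real.sqrt t) := by
    rw [Real.rpow_sub ht, Real.rpow_intCast, show (3 / 2 : ℝ) = 1 + 1 / 2 by norm_num,
      Real.rpow_add ht, Real.rpow_one, ← Real.sqrt_eq_rpow]
  simp only [smul_eq_mul]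
  rw [hl, hexp, hpow, abs_of_pos (by positivity), mul_zpow]
  have : 0 < γ * t + δ := by positivity
  field_simp
  ring

/-- GIG quadrature: with modified weights
`w̄_k = c(γ,δ,p) x_k^{p+1/2} w_k`, the quadrature exactly integrates `x^r`
against `f_GIG(·|γ,δ,p)` whenever `r + p + 1/2` is an integer in `[1−n, n]`. -/
theorem gig_quadrature (γ δ p : ℝ) (hγ : 0 < γ) (hδ : 0 < δ) (n : ℕ) (hn : 1 ≤ n)
    (z : Fin n → ℝ) (hz : Function.Injective z)
    (hroot : ∀ k, Polynomial.aeval (z k) (Polynomial.hermite n) = (0 : ℝ)) :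
    let σ := Real.sqrt (γ * δ)
    let h : Fin n → ℝ := fun k =>
      1 / Polynomial.aeval (z k) (Polynomial.derivative (Polynomial.hermite n)) *
        ∫ t : ℝ, Polynomial.aeval t (Polynomial.hermite n) / (t - z k) * stdNormalPdf t
    let x : Fin n → ℝ := fun k => δ / γ * phiInv σ (z k)
    let w : Fin n → ℝ := fun k => 2 * h k / (1 + phiInv σ (z k))
    let c : ℝ := Real.sqrt (Real.pi / 2) * γ ^ p * Real.exp (-(γ * δ)) /
      (δ ^ (p + 1) * besselK p (γ * δ))
    let wbar : Fin n → ℝ := fun k => c * x k ^ (p + 1 / 2) * w k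
    ∀ r : ℝ, ∀ m : ℤ, (m : ℝ) = r + p + 1 / 2 → 1 - (n : ℤ) ≤ m → m ≤ (n : ℤ) →
      ∑ k, wbar k * x k ^ r = ∫ t in Set.Ioi (0 : ℝ), t ^ r * fGIG γ δ p t := by
  intro σ h x w c wbar r m hm hm1 hm2
  have hσ : 0 < σ := Real.sqrt_pos.2 (by positivity)
  obtain ⟨q, hq, hsymm⟩ := exists_polynomial_zpow_symm hσ hm1 hm2
  have hG := gaussHermite_quadrature_of_symm hz hroot q hq
    (f := fun t => phiInv σ t ^ m / (1 + phiInv σ t))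
    (((continuous_phiInv σ).zpow₀ m fun t => .inl (phiInv_pos hσ t).ne').div
      (continuous_const.add (continuous_phiInv σ))
      fun t => (add_pos one_pos (phiInv_pos hσ t)).ne')
    (fun t => by have := phiInv_pos hσ t; positivity) hsymm
  rw [integral_zpow_phiInv_mul_stdNormalPdf hγ hδ m] at hG
  have hL : ∑ k, wbar k * x k ^ r = 2 * c * (δ / γ) ^ m *
      ∑ k, gaussHermiteWeight n (z k) * (phiInv σ (z k) ^ m / (1 + phiInv σ (z k))) := by
    rw [Finset.mul_sum]
    refine Finset.sum_congr rfl fun k _ => ?_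
    have hy := phiInv_pos hσ (z k)
    have hx : 0 < x k := by simp only [x]; positivity
    have hxm : x k ^ (p + 1 / 2) * x k ^ r = (δ / γ) ^ m * phiInv σ (z k) ^ m := by
      rw [← Real.rpow_add hx, show p + 1 / 2 + r = (m : ℝ) by rw [hm]; ring, Real.rpow_intCast,
        ← mul_zpow]
    have hw : w k = 2 * gaussHermiteWeight n (z k) / (1 + phiInv σ (z k)) := rfl
    calc wbar k * x k ^ r = c * w k * (x k ^ (p + 1 / 2) * x k ^ r) := by simp only [wbar]; ring
      _ = _ := by
        rw [hxm, hw]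
        ring
  have hR : ∫ t in Set.Ioi (0 : ℝ), t ^ r * fGIG γ δ p t =
      (γ / δ) ^ p / (2 * besselK p (γ * δ)) * ∫ t in Ioi (0 : ℝ), t ^ ((m : ℝ) - 3 / 2) *
          Real.exp (-(γ ^ 2 * t + δ ^ 2 / t) / 2) := by
    rw [← integral_const_mul]
    refine setIntegral_congr_fun measurableSet_Ioi fun t ht => ?_
    simp only [fGIG]
    rw [show (m : ℝ) - 3 / 2 = r + (p - 1) by rw [hm]; ring, Real.rpow_add ht]
    ring
  rw [hL, hG, hR]
  simp only [c]
  rw [Real.div_rpow hγ.le hδ.le, Real.rpow_add hδ, Real.rpow_one, Real.exp_neg,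
    show Real.pi / 2 = 2 * Real.pi / 2 ^ 2 by ring, Real.sqrt_div (by positivity),
    Real.sqrt_sq (by norm_num), show γ / δ = (δ / γ)⁻¹ by rw [inv_div], inv_zpow]
  have h1 := Real.rpow_pos_of_pos hδ p
  have h2 : (δ / γ) ^ m ≠ 0 := (zpow_pos (by positivity) m).ne'
  have h3 : Real.sqrt (2 * Real.pi) ≠ 0 := by positivity
  generalize (δ / γ) ^ m = A at *
  generalize Real.sqrt (2 * Real.pi) = B at *
  field_simp
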